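/- Assume in addition that ε > 0 and that n₀ is such that for all i ∈ {1, …, r}, j ∈ {1, …, t} and k ∈ B^i[h^j], E^k_{σ[h^j]}[(1/n₀) Σ_{m=1}^{n₀} g_m] ≥ γ^i_∞ − ε. Then for every S ≥ 1, E^{p*}_{σ'}[(1/(Sn₀)) Σ_{m=1}^{Sn₀} g_m] ≥ γ^{p*}_∞(σ) − ε. -/

import Mathlib

open MeasureTheory Filter

namespace PomdpPaper

/-- A belief (probability vector) on `Fin n`. -/
def IsBelief {n : ℕ} (p : Fin n → ℝ) : Prop :=
  (∀ k, 0 ≤ p k) ∧ ∑ k, p k = 1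

/-- The measure on a finite type associated with a probability vector. -/
noncomputable def vecMeasure {α : Type*} [Fintype α] [MeasurableSpace α] (p : α → ℝ) :
    Measure α :=
  ∑ x : α, ENNReal.ofReal (p x) • Measure.dirac x

/-- The Dirac belief at a point. -/
def diracBelief {n : ℕ} (k : Fin n) : Fin n → ℝ := fun k' => if k' = k then 1 else 0

/-- The `i`-th binary digit of a real number `x ∈ [0,1)` (as a real number `0` or `1`). -/
noncomputable def digitR (x : ℝ) (i : ℕ) : ℝ :=
  if ⌊x * 2 ^ (i + 1)⌋ % 2 = 1 then 1 else 0

/-- From one uniform seed `x ∈ [0,1)`, a sequence `unif x 0, unif x 1, …` of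
(independent, uniformly distributed on `[0,1]`) real numbers, obtained by splitting the
binary digits of `x` along the pairing function. -/
noncomputable def unif (x : ℝ) (m : ℕ) : ℝ :=
  ∑' j : ℕ, digitR x (Nat.pair m j) / 2 ^ (j + 1)

open Classical in
/-- Inverse-transform sampling from a probability vector on `Fin n` using a seed `u ∈ [0,1]`. -/
noncomputable def sampleFin {n : ℕ} (hn : 0 < n) (p : Fin n → ℝ) (u : ℝ) : Fin n :=
  let s : Finset (Fin n) :=
    Finset.univ.filter fun y : Fin n => u < ∑ z ∈ Finset.univ.filter fun z : Fin n => z ≤ y, p z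
  if hs : s.Nonempty then s.min' hs else ⟨0, hn⟩

/-- Inverse-transform sampling from a probability vector on a finite nonempty type. -/
noncomputable def sampleOn {β : Type*} [Fintype β] [Nonempty β] (p : β → ℝ) (u : ℝ) : β :=
  (Fintype.equivFin β).symm
    (sampleFin Fintype.card_pos (fun i => p ((Fintype.equivFin β).symm i)) u)

/-- A POMDP with states `Fin nK`, actions `Fin nA`, signals `Fin nS`, transition function `q`
and reward function `g` with values in `[0,1]`. -/
structure POMDP where
  nK : ℕ
  nA : ℕ
  nS : ℕ
  hK : 0 < nK
  hA : 0 < nA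
  hS : 0 < nS
  q : Fin nK → Fin nA → Fin nK × Fin nS → ℝ
  q_nonneg : ∀ k a y, 0 ≤ q k a y
  q_sum : ∀ k a, ∑ y, q k a y = 1
  g : Fin nK → Fin nA → ℝ
  g_nonneg : ∀ k a, 0 ≤ g k a
  g_le_one : ∀ k a, g k a ≤ 1

namespace POMDP

variable (Γ : POMDP)

/-- The state space. -/
abbrev K := Fin Γ.nK
/-- The action space. -/
abbrev A := Fin Γ.nA
/-- The signal space. -/
abbrev S := Fin Γ.nS

instance : Nonempty Γ.K := ⟨⟨0, Γ.hK⟩⟩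
instance : Nonempty Γ.A := ⟨⟨0, Γ.hA⟩⟩
instance : Nonempty Γ.S := ⟨⟨0, Γ.hS⟩⟩

/-- A history: the finite sequence of past actions and signals. -/
abbrev Hist := List (Γ.A × Γ.S)

/-- A (pure) strategy: a map from histories to actions. -/
abbrev Strategy := Γ.Hist → Γ.A

/-- The sample space carrying all the randomness: an initial state together with a
uniform seed in `[0,1)` used to draw all the transitions. -/
abbrev Env := Γ.K × ℝ

/-- The probability measure on the sample space induced by the initial belief `p1`:
the initial state is drawn according to `p1`, the seed uniformly on `[0,1)`. -/
noncomputable def envMeasure (p1 : Γ.K → ℝ) : Measure Γ.Env :=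
  (vecMeasure p1).prod (volume.restrict (Set.Ico (0 : ℝ) 1))

/-- The trajectory: `(Γ.traj σ ω m).1` is the state `k_{m+1}` at stage `m+1` and
`(Γ.traj σ ω m).2` is the history before stage `m+1` (of length `m`), when the
decision-maker uses strategy `σ` and the randomness is `ω`.  At each stage, the pair
(new state, signal) is drawn from `q` via inverse-transform sampling from a fresh
uniform variable. -/
noncomputable def traj (σ : Γ.Strategy) (ω : Γ.Env) : ℕ → Γ.K × Γ.Hist
  | 0 => (ω.1, [])
  | m + 1 =>
    let p := traj σ ω m
    let a := σ p.2
    let y := sampleOn (Γ.q p.1 a) (unif ω.2 m)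
    (y.1, p.2 ++ [(a, y.2)])

/-- The state `k_{m+1}` at stage `m+1` (`m` is 0-indexed). -/
noncomputable def state (σ : Γ.Strategy) (ω : Γ.Env) (m : ℕ) : Γ.K := (Γ.traj σ ω m).1

/-- The history before stage `m+1` (a list of length `m`). -/
noncomputable def hist (σ : Γ.Strategy) (ω : Γ.Env) (m : ℕ) : Γ.Hist := (Γ.traj σ ω m).2

/-- The action `a_{m+1}` played at stage `m+1`. -/
noncomputable def act (σ : Γ.Strategy) (ω : Γ.Env) (m : ℕ) : Γ.A := σ (Γ.hist σ ω m)

/-- The reward `g_{m+1}` obtained at stage `m+1`. -/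
noncomputable def rew (σ : Γ.Strategy) (ω : Γ.Env) (m : ℕ) : ℝ :=
  Γ.g (Γ.state σ ω m) (Γ.act σ ω m)

/-- The average reward over the first `n` stages. -/
noncomputable def avg (σ : Γ.Strategy) (ω : Γ.Env) (n : ℕ) : ℝ :=
  (1 / n : ℝ) * ∑ m ∈ Finset.range n, Γ.rew σ ω m

/-- The probability of an event under initial belief `p1` (the strategy `σ` is recorded for
readability; the underlying measure does not depend on it). -/
noncomputable def prob (p1 : Γ.K → ℝ) (_σ : Γ.Strategy) (E : Set Γ.Env) : ℝ :=
  (Γ.envMeasure p1 E).toReal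

/-- The long-run average payoff `γ^{p1}_∞(σ) = E[liminf (1/n) ∑ g_m]`. -/
noncomputable def pay (p1 : Γ.K → ℝ) (σ : Γ.Strategy) : ℝ :=
  ∫ ω, atTop.liminf (Γ.avg σ ω) ∂(Γ.envMeasure p1)

/-- The payoff starting from a deterministic state `k`, i.e. `γ^k_∞(σ)`. -/
noncomputable def payK (k : Γ.K) (σ : Γ.Strategy) : ℝ := Γ.pay (diracBelief k) σ

/-- The value `v_∞(p1)`. -/
noncomputable def val (p1 : Γ.K → ℝ) : ℝ := ⨆ σ : Γ.Strategy, Γ.pay p1 σ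

/-- A strategy has finite memory if it is implemented by a finite-state transducer. -/
def FiniteMemory (σ : Γ.Strategy) : Prop :=
  ∃ (n : ℕ) (m0 : Fin n) (σa : Fin n → Γ.A) (σu : Fin n → Γ.A × Γ.S → Fin n),
    ∀ h : Γ.Hist, σ h = σa (h.foldl σu m0)

/-- A blind MDP: the signal set is a singleton. -/
def Blind : Prop := Γ.nS = 1

/-- The strategy induced by a sequence of actions `a_1, a_2, …` (`as m` is the action played
at stage `m+1`, regardless of the observed history). -/
def blindStrat (as : ℕ → Γ.A) : Γ.Strategy := fun h => as h.length

end POMDP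

/-- A sequence is eventually periodic if it is periodic with some period `T ≥ 1` from
some stage `N` on. -/
def EventuallyPeriodic {α : Type*} (as : ℕ → α) : Prop :=
  ∃ T ≥ 1, ∃ N ≥ 1, ∀ m ≥ N, as (m + T) = as m


namespace POMDP

variable (Γ : POMDP)

/-- `Γ.histProb p1 σ h` is the probability, under initial belief `p1` and strategy `σ`,
that the history before stage `h.length + 1` equals `h`. -/
noncomputable def histProb (p1 : Γ.K → ℝ) (σ : Γ.Strategy) (h : Γ.Hist) : ℝ :=
  Γ.prob p1 σ {ω | Γ.hist σ ω h.length = h}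

/-- The belief at stage `h.length + 1` given the history `h`:
`p_m(k) = P(k_m = k | h_m = h)` (defined via Bayes rule, i.e. as a quotient). -/
noncomputable def belief (p1 : Γ.K → ℝ) (σ : Γ.Strategy) (h : Γ.Hist) : Γ.K → ℝ :=
  fun k =>
    Γ.prob p1 σ {ω | Γ.hist σ ω h.length = h ∧ Γ.state σ ω h.length = k} /
      Γ.histProb p1 σ h

end POMDP

namespace POMDP

variable (Γ : POMDP)

/-- The `h`-shift of a strategy: `σ[h](h') = σ(h, h')`. -/
def shiftStrat (σ : Γ.Strategy) (h : Γ.Hist) : Γ.Strategy := fun h' => σ (h ++ h')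

/-- `Γ.condStateProb k σ h k'` is the conditional probability
`P^k_σ(k_{m} = k' | h_m = h)` where `m = h.length + 1`. -/
noncomputable def condStateProb (k : Γ.K) (σ : Γ.Strategy) (h : Γ.Hist) (k' : Γ.K) : ℝ :=
  Γ.prob (diracBelief k) σ
      {ω | Γ.hist σ ω h.length = h ∧ Γ.state σ ω h.length = k'} /
    Γ.prob (diracBelief k) σ {ω | Γ.hist σ ω h.length = h}

/-- The super-support after history `h` associated with the classes `Kc`:
`Γ.superSuppH σ Kc h i` is the set of states reached with positive probability after
history `h`, under `σ` and starting from a state in `Kc i`. -/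
noncomputable def superSuppH (σ : Γ.Strategy) {r : ℕ} (Kc : Fin r → Finset Γ.K)
    (h : Γ.Hist) (i : Fin r) : Set Γ.K :=
  {k' | ∃ k ∈ Kc i, 0 < Γ.condStateProb k σ h k'}

end POMDP

open Classical in
/-- A representative history for a given super-support value: some history which has
positive probability under `σ` starting from `p*` and whose super-support equals `v`
(if such a history exists). -/
noncomputable def repHistOfVal (Γ : POMDP) (pstar : Γ.K → ℝ) (σ : Γ.Strategy) {r : ℕ}
    (Kc : Fin r → Finset Γ.K) (v : Fin r → Set Γ.K) : Γ.Hist :=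
  if hx : ∃ h : Γ.Hist, 0 < Γ.histProb pstar σ h ∧ Γ.superSuppH σ Kc h = v then
    hx.choose
  else []

/-- The representative history maintained after `s` complete blocks of length `n0`, given
the full observed history `h`: `blockRep … 0 h` represents the empty history, and the
representative after `s + 1` blocks is the representative of the super-support of
(previous representative ++ the `(s+1)`-st block of `h`). -/
noncomputable def blockRep (Γ : POMDP) (pstar : Γ.K → ℝ) (σ : Γ.Strategy) {r : ℕ}
    (Kc : Fin r → Finset Γ.K) (n0 : ℕ) : ℕ → Γ.Hist → Γ.Hist
  | 0, _ => repHistOfVal Γ pstar σ Kc (Γ.superSuppH σ Kc [])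
  | s + 1, h =>
    repHistOfVal Γ pstar σ Kc
      (Γ.superSuppH σ Kc
        (blockRep Γ pstar σ Kc n0 s h ++ (h.drop (s * n0)).take n0))

/-- The finite-memory strategy `σ'`: during the block of stages `s·n0 + 1, …, (s+1)·n0`,
play as `σ` would play after the maintained representative history followed by the
history collected since stage `s·n0 + 1`. -/
noncomputable def pomdpSigma' (Γ : POMDP) (pstar : Γ.K → ℝ) (σ : Γ.Strategy) {r : ℕ}
    (Kc : Fin r → Finset Γ.K) (n0 : ℕ) : Γ.Strategy :=
  fun h =>
    σ (blockRep Γ pstar σ Kc n0 (h.length / n0) h ++ h.drop (h.length / n0 * n0))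

/-! ### Part 1: the seed generates iid uniform variables -/

noncomputable def lam : Measure ℝ := volume.restrict (Set.Ico (0 : ℝ) 1)

noncomputable def bern : Measure ℝ :=
  (1 / 2 : ENNReal) • Measure.dirac 0 + (1 / 2 : ENNReal) • Measure.dirac 1

instance : IsProbabilityMeasure lam := ⟨by simp [lam]⟩

instance : IsProbabilityMeasure bern := ⟨by
  simp [bern, ENNReal.inv_two_add_inv_two]⟩

lemma measurable_digitR (i : ℕ) : Measurable (fun x => digitR x i) := by
  unfold digitR
  refine Measurable.ite ?_ measurable_const measurable_const
  have h : Measurable (fun x : ℝ => ⌊x * 2 ^ (i + 1)⌋) :=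
    Int.measurable_floor.comp (measurable_id.mul_const _)
  exact h (MeasurableSet.of_discrete (s := {z : ℤ | z % 2 = 1}))

lemma digitR_half_zero (x : ℝ) (hx : x ∈ Set.Ico (0:ℝ) 1) (c : ℕ) (hc : c = 0 ∨ c = 1) :
    digitR ((x + c) / 2) 0 = c := by
  have : ⌊(x + c) / 2 * 2 ^ (0 + 1)⌋ = c := by
    rw [Int.floor_eq_iff]
    obtain ⟨h1, h2⟩ := hx
    push_cast
    constructor <;> nlinarith
  unfold digitR
  rw [this]
  rcases hc with rfl | rfl <;> simp

lemma digitR_half_succ (x : ℝ) (c : ℕ) (i : ℕ) :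
    digitR ((x + c) / 2) (i + 1) = digitR x i := by
  have : (x + c) / 2 * 2 ^ (i + 1 + 1) = x * 2 ^ (i + 1) + ((c * 2 ^ (i + 1) : ℤ) : ℝ) := by
    push_cast; ring
  unfold digitR
  have h2 : (⌊x * 2 ^ (i + 1)⌋ + (c : ℤ) * 2 ^ (i + 1)) % 2 = ⌊x * 2 ^ (i + 1)⌋ % 2 := by
    have : (c : ℤ) * 2 ^ (i + 1) = (c * 2 ^ i) * 2 := by ring
    rw [this, Int.add_mul_emod_self_right]
  rw [this, Int.floor_add_intCast, h2]

lemma lam_split (E : Set ℝ) (hE : MeasurableSet E) :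
    lam E = 1 / 2 * lam {x | (x + (0 : ℕ)) / 2 ∈ E} + 1 / 2 * lam {x | (x + (1 : ℕ)) / 2 ∈ E} := by
  have key : ∀ c : ℕ, 1 / 2 * lam {x | (x + c) / 2 ∈ E}
      = volume (E ∩ Set.Ico ((c : ℝ) / 2) ((c + 1) / 2)) := by
    intro c
    have hm : MeasurableSet {x : ℝ | (x + c) / 2 ∈ E} := by
      have : Measurable (fun x : ℝ => (x + c) / 2) := by fun_prop
      exact this hE
    rw [lam, Measure.restrict_apply hm]
    have h1 : {x : ℝ | (x + c) / 2 ∈ E} ∩ Set.Ico 0 1 =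
        (fun x => x + (c : ℝ)) ⁻¹' ((fun x => (1 / 2 : ℝ) * x) ⁻¹'
          (E ∩ Set.Ico ((c : ℝ) / 2) ((c + 1) / 2))) := by
      ext x
      have : (x + c) / 2 = 1 / 2 * (x + c) := by ring
      simp only [Set.mem_inter_iff, Set.mem_ofPred_eq, Set.mem_preimage, Set.mem_Ico, this]
      refine and_congr_right fun _ => ?_
      constructor <;> rintro ⟨h1, h2⟩ <;> constructor <;> linarith
    rw [h1, measure_preimage_add_right, Real.volume_preimage_mul_left (by norm_num), ← mul_assoc]
    have : (1 / 2 : ENNReal) * ENNReal.ofReal |(1 / 2 : ℝ)⁻¹| = 1 := by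
      norm_num
      exact ENNReal.inv_mul_cancel (by norm_num) (by norm_num)
    rw [this, one_mul]
  rw [key, key, lam, Measure.restrict_apply hE, ← measure_union]
  · congr 1
    have h1 : (((0 : ℕ) : ℝ) + 1) / 2 = ((1 : ℕ) : ℝ) / 2 := by norm_num
    rw [← Set.inter_union_distrib_left, h1, Set.Ico_union_Ico_eq_Ico] <;> norm_num
  · refine Disjoint.mono Set.inter_subset_right Set.inter_subset_right ?_
    rw [Set.disjoint_left]
    rintro x ⟨_, h1⟩ ⟨h2, _⟩
    norm_num at h1 h2
    linarith
  · exact hE.inter measurableSet_Ico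

lemma bern_apply (t : Set ℝ) (ht : MeasurableSet t) :
    bern t = 1 / 2 * t.indicator 1 0 + 1 / 2 * t.indicator 1 1 := by
  simp [bern, ht]

lemma lam_cyl (n : ℕ) : ∀ t : ℕ → Set ℝ, (∀ i, MeasurableSet (t i)) →
    lam {x | ∀ i < n, digitR x i ∈ t i} = ∏ i ∈ Finset.range n, bern (t i) := by
  induction n with
  | zero => intro t _; simp
  | succ n ih =>
    intro t ht
    have hm : MeasurableSet {x | ∀ i < n + 1, digitR x i ∈ t i} := by
      simp only [Set.ofPred_forall]
      exact MeasurableSet.iInter fun i => MeasurableSet.iInter fun _ =>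
        measurable_digitR i (ht i)
    have key : ∀ c : ℕ, (c = 0 ∨ c = 1) →
        lam {x | (x + (c : ℕ)) / 2 ∈ {x | ∀ i < n + 1, digitR x i ∈ t i}}
        = (t 0).indicator 1 (c : ℝ) * ∏ i ∈ Finset.range n, bern (t (i + 1)) := by
      intro c hc
      rw [← ih (fun i => t (i + 1)) (fun i => ht _)]
      by_cases h : (c : ℝ) ∈ t 0
      · rw [Set.indicator_of_mem h, Pi.one_apply, one_mul]
        refine measure_congr ?_
        rw [lam]
        filter_upwards [ae_restrict_mem measurableSet_Ico] with x hx
        refine propext ?_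
        change (∀ i < n + 1, digitR ((x + c) / 2) i ∈ t i) ↔ ∀ i < n, digitR x i ∈ t (i + 1)
        constructor
        · intro H i hi
          have := H (i + 1) (by omega)
          rwa [digitR_half_succ] at this
        · intro H i hi
          cases i with
          | zero => rwa [digitR_half_zero x hx c hc]
          | succ i => rw [digitR_half_succ]; exact H i (by omega)
      · rw [Set.indicator_of_notMem h, zero_mul]
        rw [← nonpos_iff_eq_zero, ← measure_empty (μ := lam)]
        refine (measure_congr ?_).le
        rw [lam]
        filter_upwards [ae_restrict_mem measurableSet_Ico] with x hx
        refine propext ?_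
        change (∀ i < n + 1, digitR ((x + c) / 2) i ∈ t i) ↔ False
        refine iff_false_intro fun H => h ?_
        have := H 0 (by omega)
        rwa [digitR_half_zero x hx c hc] at this
    rw [lam_split _ hm, key 0 (Or.inl rfl), key 1 (Or.inr rfl), Finset.prod_range_succ',
      bern_apply _ (ht 0)]
    push_cast
    ring

lemma map_digits : lam.map (fun x i => digitR x i) = Measure.infinitePi (fun _ : ℕ => bern) := by
  have hmeas : Measurable (fun x (i : ℕ) => digitR x i) := measurable_pi_lambda _ measurable_digitR
  refine Measure.eq_infinitePi _ fun s t ht => ?_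
  classical
  rw [Measure.map_apply hmeas (MeasurableSet.pi s.countable_toSet fun i _ => ht i)]
  obtain ⟨n, hn⟩ := s.exists_nat_subset_range
  have := lam_cyl n (fun i => if i ∈ s then t i else Set.univ) (fun i => by
    split_ifs
    exacts [ht i, MeasurableSet.univ])
  have h2 : (fun x (i : ℕ) => digitR x i) ⁻¹' (Set.pi s t) =
      {x | ∀ i < n, digitR x i ∈ if i ∈ s then t i else Set.univ} := by
    ext x
    simp only [Set.mem_preimage, Set.mem_pi, Set.mem_ofPred_eq, Finset.mem_coe]
    constructor
    · intro H i _
      split_ifs with h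
      · exact H i h
      · trivial
    · intro H i hi
      have := H i (Finset.mem_range.1 (hn hi))
      rwa [if_pos hi] at this
  rw [h2, this, ← Finset.prod_subset hn]
  · exact Finset.prod_congr rfl fun i hi => by rw [if_pos hi]
  · intro i _ hi
    rw [if_neg hi, measure_univ]

noncomputable def bsum (w : ℕ → ℝ) : ℝ := ∑' j : ℕ, (max 0 (min 1 (w j))) / 2 ^ (j + 1)

lemma measurable_bsum : Measurable bsum := by
  refine Continuous.measurable ?_
  unfold bsum
  refine continuous_tsum (u := fun j : ℕ => 1 / 2 ^ (j + 1)) (fun j => by fun_prop) ?_ ?_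
  · have := (summable_nat_add_iff 1).2 summable_geometric_two
    simpa using this
  · intro j w
    rw [Real.norm_eq_abs, abs_of_nonneg (by positivity)]
    gcongr
    simp

lemma digitR_mem (x : ℝ) (i : ℕ) : max 0 (min 1 (digitR x i)) = digitR x i := by
  unfold digitR; split_ifs <;> simp

lemma unif_eq (x : ℝ) (m : ℕ) : unif x m = bsum (fun j => digitR x (Nat.pair m j)) := by
  simp only [unif, bsum, digitR_mem]

lemma bsum_digits (x : ℝ) (hx : x ∈ Set.Ico (0:ℝ) 1) : bsum (fun j => digitR x j) = x := by
  have h := (Real.hasSum_ofDigitsTerm_digits x (b := 2) (by norm_num) hx).tsum_eq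
  refine Eq.trans ?_ h
  simp only [bsum, digitR_mem]
  refine tsum_congr fun j => ?_
  have h0 : 0 ≤ x * 2 ^ (j + 1) := mul_nonneg hx.1 (by positivity)
  have hfl : ⌊x * 2 ^ (j + 1)⌋ = ((⌊x * 2 ^ (j + 1)⌋₊ : ℕ) : ℤ) := (Int.natCast_floor_eq_floor h0).symm
  simp only [Real.ofDigitsTerm, Real.digits, digitR, hfl]
  have h2 : ((Fin.ofNat 2 ⌊x * 2 ^ (j + 1)⌋₊ : Fin 2) : ℕ) = ⌊x * 2 ^ (j + 1)⌋₊ % 2 := rfl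
  push_cast
  rw [h2]
  rcases Nat.mod_two_eq_zero_or_one ⌊x * 2 ^ (j + 1)⌋₊ with h | h
  · rw [if_neg (by omega), h]; simp
  · rw [if_pos (by omega), h]; simp [div_eq_mul_inv]

lemma map_bsum : (Measure.infinitePi (fun _ : ℕ => bern)).map bsum = lam := by
  rw [← map_digits, Measure.map_map measurable_bsum (measurable_pi_lambda _ measurable_digitR)]
  conv_rhs => rw [← Measure.map_id (μ := lam)]
  refine Measure.map_congr ?_
  rw [lam]
  filter_upwards [ae_restrict_mem measurableSet_Ico] with x hx
  exact bsum_digits x hx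

lemma measurable_unif (m : ℕ) : Measurable (fun x => unif x m) := by
  simp only [unif_eq]
  exact measurable_bsum.comp (measurable_pi_lambda _ fun j => measurable_digitR _)

lemma map_unif : lam.map (fun x m => unif x m) = Measure.infinitePi (fun _ : ℕ => lam) := by
  have e : (fun x m => unif x m) = (fun (w : ℕ → ℕ → ℝ) (m : ℕ) => bsum (w m)) ∘
      (MeasurableEquiv.curry ℕ ℕ ℝ) ∘
      (fun (w : ℕ → ℝ) (p : ℕ × ℕ) => w (Nat.pair p.1 p.2)) ∘ (fun x i => digitR x i) := by
    ext x m
    exact unif_eq x m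
  have m0 : Measurable (fun x (i : ℕ) => digitR x i) := measurable_pi_lambda _ measurable_digitR
  have m1 : Measurable (fun (w : ℕ → ℝ) (p : ℕ × ℕ) => w (Nat.pair p.1 p.2)) := by fun_prop
  have m2 := (MeasurableEquiv.curry ℕ ℕ ℝ).measurable
  have m3 : Measurable (fun (w : ℕ → ℕ → ℝ) (m : ℕ) => bsum (w m)) :=
    measurable_pi_lambda _ fun m => measurable_bsum.comp (measurable_pi_apply m)
  have hinj : Function.Injective (fun p : ℕ × ℕ => Nat.pair p.1 p.2) :=
    Nat.pairEquiv.injective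
  rw [e, ← Measure.map_map m3 (m2.comp (m1.comp m0)), ← Measure.map_map m2 (m1.comp m0),
    ← Measure.map_map m1 m0, map_digits,
    Measure.map_infinitePi_infinitePi_of_inj (P := fun _ : ℕ => bern) hinj,
    Measure.infinitePi_map_curry (fun _ _ : ℕ => bern),
    Measure.infinitePi_map_pi (f := fun _ => bsum) _ (fun _ => measurable_bsum)]
  simp only [map_bsum]

lemma map_unif_one (m : ℕ) : lam.map (fun x => unif x m) = lam := by
  have h := congrArg (Measure.map (fun w : ℕ → ℝ => w m)) map_unif
  rw [Measure.infinitePi_map_eval, Measure.map_map (measurable_pi_apply m)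
    (measurable_pi_lambda _ measurable_unif)] at h
  exact h

lemma indep_unif : ProbabilityTheory.iIndepFun (fun m x => unif x m) lam := by
  rw [ProbabilityTheory.iIndepFun_iff_map_fun_eq_infinitePi_map measurable_unif]
  simp only [map_unif_one]
  exact map_unif

/-! ### Part 2: sampling -/

lemma sampleFin_iff {n : ℕ} (hn : 0 < n) (p : Fin n → ℝ) (h0 : ∀ y, 0 ≤ p y) (h1 : ∑ y, p y = 1)
    (u : ℝ) (hu : u ∈ Set.Ico (0:ℝ) 1) (y : Fin n) :
    sampleFin hn p u = y ↔ u ∈ Set.Ico (∑ z ∈ Finset.univ.filter fun z : Fin n => z < y, p z)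
      (∑ z ∈ Finset.univ.filter fun z : Fin n => z ≤ y, p z) := by
  unfold sampleFin
  simp only
  have hne : (Finset.univ.filter fun y : Fin n =>
      u < ∑ z ∈ Finset.univ.filter fun z : Fin n => z ≤ y, p z).Nonempty := by
    refine ⟨⟨n - 1, by omega⟩, ?_⟩
    rw [Finset.mem_filter]
    refine ⟨Finset.mem_univ _, ?_⟩
    have : (Finset.univ.filter fun z : Fin n => z ≤ ⟨n - 1, by omega⟩) = Finset.univ := by
      ext z
      simp only [Finset.mem_filter, Finset.mem_univ, true_and, iff_true, Fin.le_def]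
      omega
    rw [this, h1]
    exact hu.2
  rw [dif_pos (by convert hne), Finset.min'_eq_iff]
  simp only [Finset.mem_filter, Finset.mem_univ, true_and, Set.mem_Ico]
  constructor
  · rintro ⟨ha, hb⟩
    refine ⟨?_, ha⟩
    by_contra hcon
    push Not at hcon
    by_cases hy : y.val = 0
    · have : (Finset.univ.filter fun z : Fin n => z < y) = ∅ := by
        ext z
        simp [Fin.lt_def, hy]
      rw [this, Finset.sum_empty] at hcon
      linarith [hu.1]
    · have hlt : y.val - 1 < n := by omega
      have : (Finset.univ.filter fun z : Fin n => z < y) =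
          Finset.univ.filter fun z : Fin n => z ≤ ⟨y.val - 1, hlt⟩ := by
        ext z
        simp only [Finset.mem_filter, Finset.mem_univ, true_and, Fin.le_def, Fin.lt_def]
        omega
      rw [this] at hcon
      have := hb _ hcon
      simp only [Fin.le_def] at this
      omega
  · rintro ⟨ha, hb⟩
    refine ⟨hb, fun y' hy' => ?_⟩
    by_contra hlt
    push Not at hlt
    have : ∑ z ∈ Finset.univ.filter (fun z : Fin n => z ≤ y'), p z ≤
        ∑ z ∈ Finset.univ.filter (fun z : Fin n => z < y), p z := by
      refine Finset.sum_le_sum_of_subset_of_nonneg ?_ fun i _ _ => h0 i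
      intro z
      simp only [Finset.mem_filter, Finset.mem_univ, true_and]
      exact fun h => lt_of_le_of_lt h hlt
    linarith

lemma measurable_sampleFin {n : ℕ} (hn : 0 < n) (p : Fin n → ℝ) :
    Measurable (sampleFin hn p) := by
  classical
  let φ : (Fin n → Prop) → Fin n := fun P =>
    if hs : (Finset.univ.filter fun y => P y).Nonempty then
      (Finset.univ.filter fun y => P y).min' hs else ⟨0, hn⟩
  have h1 : Measurable (fun (u : ℝ) (y : Fin n) =>
      u < ∑ z ∈ Finset.univ.filter fun z : Fin n => z ≤ y, p z) := by
    refine measurable_pi_lambda _ fun y => ?_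
    refine measurable_to_prop ?_
    have : (fun (u : ℝ) => u < ∑ z ∈ Finset.univ.filter fun z : Fin n => z ≤ y, p z) ⁻¹' {True}
      = Set.Iio (∑ z ∈ Finset.univ.filter fun z : Fin n => z ≤ y, p z) := by
      ext u; simp
    rw [this]
    exact measurableSet_Iio
  have h2 : Measurable φ := Measurable.of_discrete
  convert h2.comp h1 using 1
  funext u
  simp only [sampleFin, φ, Function.comp]

lemma lam_sampleFin {n : ℕ} (hn : 0 < n) (p : Fin n → ℝ) (h0 : ∀ y, 0 ≤ p y)
    (h1 : ∑ y, p y = 1) (y : Fin n) :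
    lam (sampleFin hn p ⁻¹' {y}) = ENNReal.ofReal (p y) := by
  set a := ∑ z ∈ Finset.univ.filter fun z : Fin n => z < y, p z with ha
  set b := ∑ z ∈ Finset.univ.filter fun z : Fin n => z ≤ y, p z with hb
  have hab : b = a + p y := by
    rw [hb, ha]
    have : (Finset.univ.filter fun z : Fin n => z ≤ y) =
        insert y (Finset.univ.filter fun z : Fin n => z < y) := by
      ext z
      simp [le_iff_eq_or_lt]
    rw [this, Finset.sum_insert (by simp), add_comm]
  have ha0 : 0 ≤ a := Finset.sum_nonneg fun i _ => h0 i
  have hb1 : b ≤ 1 := by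
    rw [hb, ← h1]
    exact Finset.sum_le_sum_of_subset_of_nonneg (Finset.subset_univ _) fun i _ _ => h0 i
  rw [lam, Measure.restrict_apply (measurable_sampleFin hn p (measurableSet_singleton y))]
  have : sampleFin hn p ⁻¹' {y} ∩ Set.Ico (0:ℝ) 1 = Set.Ico a b := by
    ext u
    constructor
    · rintro ⟨h, hu⟩
      exact (sampleFin_iff hn p h0 h1 u hu y).1 h
    · intro h
      have hu : u ∈ Set.Ico (0:ℝ) 1 := ⟨ha0.trans h.1, h.2.trans_le hb1⟩
      exact ⟨(sampleFin_iff hn p h0 h1 u hu y).2 h, hu⟩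
  rw [this, Real.volume_Ico, hab]
  congr 1
  ring

lemma measurable_sampleOn {β : Type*} [Fintype β] [Nonempty β] [MeasurableSpace β]
    (p : β → ℝ) : Measurable (sampleOn p) := by
  unfold sampleOn
  exact (Measurable.of_discrete (f := (Fintype.equivFin β).symm)).comp (measurable_sampleFin _ _)

lemma integral_sampleOn {β : Type*} [Fintype β] [Nonempty β]
    (p : β → ℝ) (h0 : ∀ y, 0 ≤ p y) (h1 : ∑ y, p y = 1) (f : β → ℝ) :
    ∫ u, f (sampleOn p u) ∂lam = ∑ y, p y * f y := by
  unfold sampleOn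
  have hm := measurable_sampleFin (Fintype.card_pos (α := β))
    (fun i => p ((Fintype.equivFin β).symm i))
  rw [← integral_map (f := fun i => f ((Fintype.equivFin β).symm i)) hm.aemeasurable
    (Measurable.of_discrete.aestronglyMeasurable)]
  have := Measure.isProbabilityMeasure_map (μ := lam) hm.aemeasurable
  rw [integral_fintype Integrable.of_finite, ← (Fintype.equivFin β).symm.sum_comp]
  refine Finset.sum_congr rfl fun i _ => ?_
  rw [measureReal_def, Measure.map_apply hm (measurableSet_singleton i), lam_sampleFin _ _
    (fun i => h0 _) (by rw [(Fintype.equivFin β).symm.sum_comp]; exact h1),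
    ENNReal.toReal_ofReal (h0 _), smul_eq_mul]

/-! ### Part 3: the transition operator -/

namespace POMDP

variable (Γ : POMDP)

local instance histMS : MeasurableSpace Γ.Hist := ⊤
local instance histDMS : DiscreteMeasurableSpace Γ.Hist := ⟨fun _ => trivial⟩

/-- next position -/
def nxt (σ : Γ.Strategy) (z : Γ.K × Γ.Hist) (y : Γ.K × Γ.S) : Γ.K × Γ.Hist :=
  (y.1, z.2 ++ [(σ z.2, y.2)])

noncomputable def stepF (σ : Γ.Strategy) (z : Γ.K × Γ.Hist) (u : ℝ) : Γ.K × Γ.Hist :=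
  Γ.nxt σ z (sampleOn (Γ.q z.1 (σ z.2)) u)

/-- transition operator -/
noncomputable def T (σ : Γ.Strategy) (F : Γ.K × Γ.Hist → ℝ) (z : Γ.K × Γ.Hist) : ℝ :=
  ∑ y, Γ.q z.1 (σ z.2) y * F (Γ.nxt σ z y)

noncomputable def trajU (σ : Γ.Strategy) (k : Γ.K) (u : ℕ → ℝ) : ℕ → Γ.K × Γ.Hist
  | 0 => (k, [])
  | m + 1 => Γ.stepF σ (trajU σ k u m) (u m)

lemma traj_eq (σ : Γ.Strategy) (k : Γ.K) (x : ℝ) (m : ℕ) :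
    Γ.traj σ (k, x) m = Γ.trajU σ k (fun m => unif x m) m := by
  induction m with
  | zero => rfl
  | succ m ih => simp only [traj, trajU, ih]; rfl

lemma measurable_stepF (σ : Γ.Strategy) :
    Measurable (Function.uncurry (Γ.stepF σ)) := by
  refine measurable_from_prod_countable_right fun z => ?_
  have h1 : Measurable (Γ.nxt σ z) := Measurable.of_discrete
  have h2 : Measurable (sampleOn (Γ.q z.1 (σ z.2))) := measurable_sampleOn _
  exact h1.comp h2

lemma measurable_trajU (σ : Γ.Strategy) (k : Γ.K) (m : ℕ) :
    Measurable (fun u => Γ.trajU σ k u m) := by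
  induction m with
  | zero => exact measurable_const
  | succ m ih =>
    have h1 : Measurable (fun u : ℕ → ℝ => (Γ.trajU σ k u m, u m)) :=
      ih.prodMk (measurable_pi_apply m)
    have h2 := (Γ.measurable_stepF σ).comp h1
    simp only [Function.comp_def, Function.uncurry_apply_pair] at h2
    simp only [trajU]
    exact h2

lemma trajU_congr (σ : Γ.Strategy) (k : Γ.K) (m : ℕ) (u v : ℕ → ℝ) (h : ∀ i < m, u i = v i) :
    Γ.trajU σ k u m = Γ.trajU σ k v m := by
  induction m with
  | zero => rfl
  | succ m ih =>
    simp only [trajU]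
    rw [ih fun i hi => h i (by omega), h m (by omega)]

lemma measurable_traj (σ : Γ.Strategy) (k : Γ.K) (m : ℕ) :
    Measurable (fun x => Γ.traj σ (k, x) m) := by
  simp only [traj_eq]
  exact (Γ.measurable_trajU σ k m).comp (measurable_pi_lambda _ measurable_unif)

lemma indep_traj (σ : Γ.Strategy) (k : Γ.K) (m : ℕ) :
    ProbabilityTheory.IndepFun (fun x => Γ.traj σ (k, x) m) (fun x => unif x m) lam := by
  classical
  have h := indep_unif.indepFun_finset (Finset.range m) {m} (by simp) measurable_unif
  let ext : (Finset.range m → ℝ) → ℕ → ℝ := fun v i => if hi : i ∈ Finset.range m then v ⟨i, hi⟩ else 0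
  have hext : Measurable ext := by
    refine measurable_pi_lambda _ fun i => ?_
    by_cases hi : i ∈ Finset.range m
    · simp only [ext, dif_pos hi]; exact measurable_pi_apply _
    · simp only [ext, dif_neg hi]; exact measurable_const
  have h2 := h.comp ((Γ.measurable_trajU σ k m).comp hext)
    (measurable_pi_apply (⟨m, Finset.mem_singleton_self m⟩ : ({m} : Finset ℕ)))
  have e : (fun x => Γ.traj σ (k, x) m) =
      (((fun u => Γ.trajU σ k u m) ∘ ext) ∘ fun a (i : Finset.range m) => unif a i) := by
    funext x
    rw [traj_eq]
    refine Γ.trajU_congr σ k m _ _ fun i hi => ?_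
    simp [ext, hi]
  rw [e]
  exact h2

lemma T_bound (σ : Γ.Strategy) (F : Γ.K × Γ.Hist → ℝ) (C : ℝ) (hF : ∀ z, |F z| ≤ C) (z) :
    |Γ.T σ F z| ≤ C := by
  unfold T
  refine (Finset.abs_sum_le_sum_abs _ _).trans ?_
  calc _ ≤ ∑ y, Γ.q z.1 (σ z.2) y * C := by
        refine Finset.sum_le_sum fun y _ => ?_
        rw [abs_mul, abs_of_nonneg (Γ.q_nonneg _ _ _)]
        exact mul_le_mul_of_nonneg_left (hF _) (Γ.q_nonneg _ _ _)
    _ = C := by rw [← Finset.sum_mul, Γ.q_sum, one_mul]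

lemma integral_step (σ : Γ.Strategy) (k : Γ.K) (m : ℕ) (F : Γ.K × Γ.Hist → ℝ) (C : ℝ)
    (hF : ∀ z, |F z| ≤ C) :
    ∫ x, F (Γ.traj σ (k, x) (m + 1)) ∂lam = ∫ x, Γ.T σ F (Γ.traj σ (k, x) m) ∂lam := by
  have hX := Γ.measurable_traj σ k m
  have hU := measurable_unif m
  have hG : Measurable (F ∘ Function.uncurry (Γ.stepF σ)) :=
    (Measurable.of_discrete (f := F)).comp (Γ.measurable_stepF σ)
  have e1 : ∀ x, F (Γ.traj σ (k, x) (m + 1)) =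
      (F ∘ Function.uncurry (Γ.stepF σ)) (Γ.traj σ (k, x) m, unif x m) :=
    fun x => rfl
  have hprod := (Γ.indep_traj σ k m).map_prod_eq_prod_map_map hX.aemeasurable hU.aemeasurable
  rw [map_unif_one] at hprod
  have := Measure.isProbabilityMeasure_map (μ := lam) hX.aemeasurable
  simp only [e1]
  rw [← integral_map (f := F ∘ Function.uncurry (Γ.stepF σ))
      (hX.prodMk hU).aemeasurable hG.aestronglyMeasurable, hprod, integral_prod,
    ← integral_map (f := fun z => Γ.T σ F z) hX.aemeasurable
      (Measurable.of_discrete.aestronglyMeasurable)]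
  · refine integral_congr_ae (Eventually.of_forall fun z => ?_)
    simp only [Function.comp_apply, Function.uncurry_apply_pair, stepF, T]
    exact integral_sampleOn (Γ.q z.1 (σ z.2)) (Γ.q_nonneg _ _) (Γ.q_sum _ _)
      (fun y => F (Γ.nxt σ z y))
  · exact Integrable.of_bound hG.aestronglyMeasurable C (Eventually.of_forall fun p => hF _)

lemma integral_traj (σ : Γ.Strategy) (k : Γ.K) (m : ℕ) : ∀ (F : Γ.K × Γ.Hist → ℝ) (C : ℝ)
    (_ : ∀ z, |F z| ≤ C),
    ∫ x, F (Γ.traj σ (k, x) m) ∂lam = (Γ.T σ)^[m] F (k, []) := by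
  induction m with
  | zero => intro F C hF; simp [traj]
  | succ m ih =>
    intro F C hF
    rw [Γ.integral_step σ k m F C hF, ih _ C (Γ.T_bound σ F C hF), Function.iterate_succ_apply]

/-! envMeasure -/

lemma vecMeasure_dirac (k : Γ.K) : vecMeasure (diracBelief k) = Measure.dirac k := by
  unfold vecMeasure diracBelief
  rw [Finset.sum_eq_single k]
  · simp
  · intro b _ hb; simp [hb]
  · simp

lemma env_dirac (k : Γ.K) : Γ.envMeasure (diracBelief k) = lam.map (fun x => (k, x)) := by
  unfold envMeasure
  rw [vecMeasure_dirac, Measure.dirac_prod]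
  rfl

instance (k : Γ.K) : IsProbabilityMeasure (Γ.envMeasure (diracBelief k)) := by
  rw [env_dirac]
  exact Measure.isProbabilityMeasure_map (by fun_prop)

lemma env_eq (p : Γ.K → ℝ) : Γ.envMeasure p =
    ∑ k, ENNReal.ofReal (p k) • Γ.envMeasure (diracBelief k) := by
  refine Measure.ext fun s hs => ?_
  simp only [env_dirac]
  have h : ∀ k : Γ.K, Measure.map (fun x => (k, x)) lam s = lam (Prod.mk k ⁻¹' s) := fun k =>
    Measure.map_apply (by fun_prop) hs
  simp only [Measure.coe_finsetSum, Finset.sum_apply, Measure.smul_apply, h, smul_eq_mul]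
  rw [envMeasure, Measure.prod_apply hs, vecMeasure, lintegral_finsetSum_measure]
  simp only [lintegral_smul_measure, lintegral_dirac, smul_eq_mul]
  rfl

lemma integral_env (p : Γ.K → ℝ) (hp : ∀ k, 0 ≤ p k) (f : Γ.Env → ℝ)
    (hf : ∀ k, 0 < p k → Integrable f (Γ.envMeasure (diracBelief k))) :
    ∫ ω, f ω ∂(Γ.envMeasure p) = ∑ k, p k * ∫ ω, f ω ∂(Γ.envMeasure (diracBelief k)) := by
  rw [env_eq, integral_finsetSum_measure]
  · refine Finset.sum_congr rfl fun k _ => ?_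
    rw [integral_smul_measure, ENNReal.toReal_ofReal (hp k), smul_eq_mul]
  · intro k _
    rcases (hp k).eq_or_lt with h | h
    · rw [← h]; simp
    · exact (hf k h).smul_measure ENNReal.ofReal_ne_top

/-! ### Part 4: reachability -/

def Reach (σ : Γ.Strategy) : ℕ → Γ.K × Γ.Hist → Γ.K × Γ.Hist → Prop
  | 0, z, z' => z = z'
  | m + 1, z, z' => ∃ y, 0 < Γ.q z.1 (σ z.2) y ∧ Reach σ m (Γ.nxt σ z y) z'

lemma T_nonneg (σ : Γ.Strategy) (m : ℕ) (F : Γ.K × Γ.Hist → ℝ) (hF : ∀ z, 0 ≤ F z) :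
    ∀ z, 0 ≤ (Γ.T σ)^[m] F z := by
  induction m with
  | zero => exact hF
  | succ m ih =>
    intro z
    rw [Function.iterate_succ_apply']
    exact Finset.sum_nonneg fun y _ => mul_nonneg (Γ.q_nonneg _ _ _) (ih _)

lemma T_pos_iff (σ : Γ.Strategy) (m : ℕ) (F : Γ.K × Γ.Hist → ℝ) (hF : ∀ z, 0 ≤ F z) :
    ∀ z, 0 < (Γ.T σ)^[m] F z ↔ ∃ z', Γ.Reach σ m z z' ∧ 0 < F z' := by
  induction m with
  | zero => intro z; simp [Reach]
  | succ m ih =>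
    intro z
    rw [Function.iterate_succ_apply']
    have hn : ∀ y ∈ (Finset.univ : Finset (Γ.K × Γ.S)),
        0 ≤ Γ.q z.1 (σ z.2) y * (Γ.T σ)^[m] F (Γ.nxt σ z y) := fun y _ =>
      mul_nonneg (Γ.q_nonneg _ _ _) (Γ.T_nonneg σ m F hF _)
    rw [T, Finset.sum_pos_iff_of_nonneg hn]
    constructor
    · rintro ⟨y, _, hy⟩
      have hq : 0 < Γ.q z.1 (σ z.2) y := by
        refine lt_of_le_of_ne (Γ.q_nonneg _ _ _) fun h => ?_
        rw [← h, zero_mul] at hy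
        exact lt_irrefl _ hy
      have h2 := (pos_iff_pos_of_mul_pos hy).1 hq
      obtain ⟨z', hz', hz''⟩ := (ih _).1 h2
      exact ⟨z', ⟨y, hq, hz'⟩, hz''⟩
    · rintro ⟨z', ⟨y, hq, hz'⟩, hz''⟩
      exact ⟨y, Finset.mem_univ _, mul_pos hq ((ih _).2 ⟨z', hz', hz''⟩)⟩

lemma T_ge (σ : Γ.Strategy) (m : ℕ) (F : Γ.K × Γ.Hist → ℝ) (c : ℝ) :
    ∀ z, (∀ z', Γ.Reach σ m z z' → c ≤ F z') → c ≤ (Γ.T σ)^[m] F z := by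
  induction m with
  | zero => intro z h; exact h z rfl
  | succ m ih =>
    intro z h
    rw [Function.iterate_succ_apply', T]
    calc c = ∑ y, Γ.q z.1 (σ z.2) y * c := by rw [← Finset.sum_mul, Γ.q_sum, one_mul]
      _ ≤ _ := by
        refine Finset.sum_le_sum fun y _ => ?_
        rcases (Γ.q_nonneg z.1 (σ z.2) y).eq_or_lt with h0 | h0
        · rw [← h0]; simp
        · exact mul_le_mul_of_nonneg_left (ih _ fun z' hz' => h z' ⟨y, h0, hz'⟩) h0.le

lemma T_mono (σ : Γ.Strategy) (m : ℕ) (F F' : Γ.K × Γ.Hist → ℝ) (h : ∀ z, F z ≤ F' z) :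
    ∀ z, (Γ.T σ)^[m] F z ≤ (Γ.T σ)^[m] F' z := by
  induction m with
  | zero => exact h
  | succ m ih =>
    intro z
    rw [Function.iterate_succ_apply', Function.iterate_succ_apply', T, T]
    exact Finset.sum_le_sum fun y _ => mul_le_mul_of_nonneg_left (ih _) (Γ.q_nonneg _ _ _)

lemma T_sum (σ : Γ.Strategy) (m n : ℕ) (f : ℕ → Γ.K × Γ.Hist → ℝ) :
    ∀ z, (Γ.T σ)^[m] (fun z => ∑ j ∈ Finset.range n, f j z) z =
      ∑ j ∈ Finset.range n, (Γ.T σ)^[m] (f j) z := by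
  induction m with
  | zero => intro z; rfl
  | succ m ih =>
    intro z
    simp only [Function.iterate_succ_apply', T, ih, Finset.mul_sum]
    rw [Finset.sum_comm]

lemma Reach_add (σ : Γ.Strategy) (m n : ℕ) : ∀ z z'', Γ.Reach σ (m + n) z z'' ↔
    ∃ z', Γ.Reach σ m z z' ∧ Γ.Reach σ n z' z'' := by
  induction m with
  | zero => intro z z''; simp [Reach]
  | succ m ih =>
    intro z z''
    rw [Nat.succ_add]
    simp only [Reach, ih]
    constructor
    · rintro ⟨y, hy, z', h1, h2⟩
      exact ⟨z', ⟨y, hy, h1⟩, h2⟩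
    · rintro ⟨z', ⟨y, hy, h1⟩, h2⟩
      exact ⟨y, hy, z', h1, h2⟩

lemma Reach_transport (σ₁ σ₂ : Γ.Strategy) (a b : Γ.Hist) (n : ℕ)
    (hag : ∀ v : Γ.Hist, v.length < n → σ₁ (a ++ v) = σ₂ (b ++ v)) (m : ℕ) :
    ∀ (k : Γ.K) (v : Γ.Hist) (z' : Γ.K × Γ.Hist), v.length + m ≤ n →
      Γ.Reach σ₁ m (k, a ++ v) z' → ∃ w : Γ.Hist, z'.2 = a ++ w ∧ w.length = v.length + m ∧
        Γ.Reach σ₂ m (k, b ++ v) (z'.1, b ++ w) := by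
  induction m with
  | zero =>
    rintro k v z' _ h
    simp only [Reach] at h
    subst h
    exact ⟨v, rfl, rfl, rfl⟩
  | succ m ih =>
    rintro k v z' hv ⟨y, hy, h⟩
    have hs := hag v (by omega)
    simp only [nxt, List.append_assoc] at h
    obtain ⟨w, h1, h2, h3⟩ := ih _ _ z' (by simp; omega) h
    refine ⟨w, h1, by simp at h2; omega, y, ?_, ?_⟩
    · simpa [hs] using hy
    · simp only [nxt, List.append_assoc]
      rw [← hs]
      exact h3

lemma T_transport (σ₁ σ₂ : Γ.Strategy) (a b : Γ.Hist) (n : ℕ)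
    (hag : ∀ v : Γ.Hist, v.length < n → σ₁ (a ++ v) = σ₂ (b ++ v))
    (F₁ F₂ : Γ.K × Γ.Hist → ℝ)
    (hF : ∀ k, ∀ v : Γ.Hist, v.length < n → F₁ (k, a ++ v) = F₂ (k, b ++ v)) (m : ℕ) :
    ∀ (k : Γ.K) (v : Γ.Hist), v.length + m < n →
      (Γ.T σ₁)^[m] F₁ (k, a ++ v) = (Γ.T σ₂)^[m] F₂ (k, b ++ v) := by
  induction m with
  | zero => intro k v hv; exact hF k v hv
  | succ m ih =>
    intro k v hv
    have hs := hag v (by omega)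
    rw [Function.iterate_succ_apply', Function.iterate_succ_apply', T, T]
    refine Finset.sum_congr rfl fun y _ => ?_
    simp only [nxt, List.append_assoc, hs]
    rw [ih _ _ (by simp; omega)]

/-! ### Part 5: probabilities -/

lemma measurable_traj_env (σ : Γ.Strategy) (m : ℕ) : Measurable (fun ω => Γ.traj σ ω m) :=
  measurable_from_prod_countable_right fun k => Γ.measurable_traj σ k m

lemma integral_dirac (σ : Γ.Strategy) (k : Γ.K) (m : ℕ) (F : Γ.K × Γ.Hist → ℝ) (C : ℝ)
    (hF : ∀ z, |F z| ≤ C) :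
    ∫ ω, F (Γ.traj σ ω m) ∂(Γ.envMeasure (diracBelief k)) = (Γ.T σ)^[m] F (k, []) := by
  have hm : Measurable (fun ω => F (Γ.traj σ ω m)) :=
    (Measurable.of_discrete (f := F)).comp (Γ.measurable_traj_env σ m)
  rw [env_dirac, integral_map (by fun_prop) hm.aestronglyMeasurable,
    Γ.integral_traj σ k m F C hF]

open Classical in
lemma prob_dirac (σ : Γ.Strategy) (k : Γ.K) (m : ℕ) (P : Γ.K × Γ.Hist → Prop) :
    Γ.prob (diracBelief k) σ {ω | P (Γ.traj σ ω m)} =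
      (Γ.T σ)^[m] (fun z => if P z then 1 else 0) (k, []) := by
  have hs : MeasurableSet {ω | P (Γ.traj σ ω m)} :=
    Γ.measurable_traj_env σ m (MeasurableSet.of_discrete (s := {z | P z}))
  rw [← Γ.integral_dirac σ k m _ 1 (fun z => by split_ifs <;> simp)]
  rw [prob, ← measureReal_def, ← integral_indicator_one hs]
  refine integral_congr_ae (Eventually.of_forall fun ω => ?_)
  simp [Set.indicator_apply]

lemma prob_dirac_pos (σ : Γ.Strategy) (k : Γ.K) (m : ℕ) (P : Γ.K × Γ.Hist → Prop) :
    0 < Γ.prob (diracBelief k) σ {ω | P (Γ.traj σ ω m)} ↔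
      ∃ z', Γ.Reach σ m (k, []) z' ∧ P z' := by
  classical
  rw [prob_dirac, T_pos_iff]
  · refine exists_congr fun z' => and_congr_right fun _ => ?_
    split_ifs with h <;> simp [h]
  · intro z; split_ifs <;> simp

lemma prob_env (σ : Γ.Strategy) (p : Γ.K → ℝ) (hp : ∀ k, 0 ≤ p k) (E : Set Γ.Env) :
    Γ.prob p σ E = ∑ k, p k * Γ.prob (diracBelief k) σ E := by
  simp only [prob]
  conv_lhs => rw [env_eq]
  simp only [Measure.coe_finsetSum, Finset.sum_apply, Measure.smul_apply, smul_eq_mul]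
  rw [ENNReal.toReal_sum]
  · refine Finset.sum_congr rfl fun k _ => ?_
    rw [ENNReal.toReal_mul, ENNReal.toReal_ofReal (hp k)]
  · intro k _
    exact ENNReal.mul_ne_top ENNReal.ofReal_ne_top (measure_ne_top _ _)

lemma histProb_pos (σ : Γ.Strategy) (p : Γ.K → ℝ) (hp : ∀ k, 0 ≤ p k) (h : Γ.Hist)
    (k k' : Γ.K) (hk : 0 < p k) (hr : Γ.Reach σ h.length (k, []) (k', h)) :
    0 < Γ.histProb p σ h := by
  rw [histProb, prob_env _ _ _ hp]
  refine Finset.sum_pos' (fun k _ => mul_nonneg (hp k) ENNReal.toReal_nonneg)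
    ⟨k, Finset.mem_univ _, mul_pos hk ?_⟩
  exact (Γ.prob_dirac_pos σ k h.length (fun z => z.2 = h)).2 ⟨_, hr, rfl⟩

lemma mem_superSupp (σ : Γ.Strategy) {r : ℕ} (Kc : Fin r → Finset Γ.K) (h : Γ.Hist) (i : Fin r)
    (k' : Γ.K) : k' ∈ Γ.superSuppH σ Kc h i ↔
      ∃ k ∈ Kc i, Γ.Reach σ h.length (k, []) (k', h) := by
  refine exists_congr fun k => and_congr_right fun _ => ?_
  have hA := Γ.prob_dirac_pos σ k h.length (fun z => z.2 = h ∧ z.1 = k')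
  have hB := Γ.prob_dirac_pos σ k h.length (fun z => z.2 = h)
  change 0 < Γ.prob (diracBelief k) σ {ω | (Γ.traj σ ω h.length).2 = h ∧
    (Γ.traj σ ω h.length).1 = k'} / Γ.prob (diracBelief k) σ {ω | (Γ.traj σ ω h.length).2 = h} ↔ _
  constructor
  · intro hpos
    have : 0 < Γ.prob (diracBelief k) σ {ω | (Γ.traj σ ω h.length).2 = h ∧
        (Γ.traj σ ω h.length).1 = k'} := by
      refine lt_of_le_of_ne ENNReal.toReal_nonneg fun h0 => ?_
      rw [← h0, zero_div] at hpos
      exact lt_irrefl _ hpos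
    obtain ⟨⟨z1, z2⟩, hz, h1, h2⟩ := hA.1 this
    simp only at h1 h2
    rw [← h2, ← h1]
    rw [h1] at hz ⊢
    exact hz
  · intro hr
    exact div_pos (hA.2 ⟨_, hr, rfl, rfl⟩) (hB.2 ⟨_, hr, rfl⟩)

noncomputable def G (σ : Γ.Strategy) (z : Γ.K × Γ.Hist) : ℝ := Γ.g z.1 (σ z.2)

lemma G_bound (σ : Γ.Strategy) (z) : |Γ.G σ z| ≤ 1 := by
  unfold G
  rw [abs_of_nonneg (Γ.g_nonneg _ _)]
  exact Γ.g_le_one _ _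

lemma integrable_rew (σ : Γ.Strategy) (k : Γ.K) (m : ℕ) :
    Integrable (fun ω => Γ.rew σ ω m) (Γ.envMeasure (diracBelief k)) := by
  have hm : Measurable (fun ω => Γ.G σ (Γ.traj σ ω m)) :=
    (Measurable.of_discrete (f := Γ.G σ)).comp (Γ.measurable_traj_env σ m)
  exact Integrable.of_bound hm.aestronglyMeasurable 1 (Eventually.of_forall fun ω => Γ.G_bound σ _)

lemma integrable_avg (σ : Γ.Strategy) (k : Γ.K) (n : ℕ) :
    Integrable (fun ω => Γ.avg σ ω n) (Γ.envMeasure (diracBelief k)) :=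
  (integrable_finsetSum _ fun m _ => Γ.integrable_rew σ k m).const_mul _

lemma integral_avg (σ : Γ.Strategy) (k : Γ.K) (n : ℕ) :
    ∫ ω, Γ.avg σ ω n ∂(Γ.envMeasure (diracBelief k)) =
      (1 / n : ℝ) * ∑ m ∈ Finset.range n, (Γ.T σ)^[m] (Γ.G σ) (k, []) := by
  unfold avg
  rw [integral_const_mul, integral_finsetSum _ fun m _ => Γ.integrable_rew σ k m]
  congr 1
  refine Finset.sum_congr rfl fun m _ => ?_
  exact Γ.integral_dirac σ k m (Γ.G σ) 1 (Γ.G_bound σ)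

end POMDP

/-! ### Part 6: blocks -/

lemma repHist_spec (Γ : POMDP) (pstar : Γ.K → ℝ) (σ : Γ.Strategy) {r : ℕ}
    (Kc : Fin r → Finset Γ.K) (h : Γ.Hist) (hh : 0 < Γ.histProb pstar σ h) :
    Γ.superSuppH σ Kc (repHistOfVal Γ pstar σ Kc (Γ.superSuppH σ Kc h)) =
      Γ.superSuppH σ Kc h := by
  have hx : ∃ h' : Γ.Hist, 0 < Γ.histProb pstar σ h' ∧
      Γ.superSuppH σ Kc h' = Γ.superSuppH σ Kc h := ⟨h, hh, rfl⟩
  rw [repHistOfVal, dif_pos hx]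
  exact hx.choose_spec.2

lemma blockRep_append (Γ : POMDP) (pstar : Γ.K → ℝ) (σ : Γ.Strategy) {r : ℕ}
    (Kc : Fin r → Finset Γ.K) (n0 : ℕ) (s : ℕ) (h w : Γ.Hist) (hl : s * n0 ≤ h.length) :
    blockRep Γ pstar σ Kc n0 s (h ++ w) = blockRep Γ pstar σ Kc n0 s h := by
  induction s with
  | zero => rfl
  | succ s ih =>
    rw [Nat.succ_mul] at hl
    simp only [blockRep]
    rw [ih (by omega), List.drop_append_of_le_length (by omega),
      List.take_append_of_le_length (by simp; omega)]

lemma sigma'_append (Γ : POMDP) (pstar : Γ.K → ℝ) (σ : Γ.Strategy) {r : ℕ}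
    (Kc : Fin r → Finset Γ.K) (n0 : ℕ) (s : ℕ) (h v : Γ.Hist) (hl : h.length = s * n0)
    (hv : v.length < n0) :
    pomdpSigma' Γ pstar σ Kc n0 (h ++ v) = σ (blockRep Γ pstar σ Kc n0 s h ++ v) := by
  have : (h ++ v).length / n0 = s := by
    rw [List.length_append, hl, add_comm, Nat.add_mul_div_right _ _ (by omega),
      Nat.div_eq_of_lt hv, zero_add]
  rw [pomdpSigma', this, blockRep_append _ _ _ _ _ _ _ _ hl.ge, ← hl, List.drop_left]

lemma block_inv (Γ : POMDP) (pstar : Γ.K → ℝ) (hp : ∀ k, 0 ≤ pstar k) (σ : Γ.Strategy) {r : ℕ}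
    (Kc : Fin r → Finset Γ.K) (hKc : ∀ k, 0 < pstar k ↔ ∃ i, k ∈ Kc i) (n0 : ℕ)
    (i : Fin r) (k : Γ.K) (hk : k ∈ Kc i) (s : ℕ) :
    ∀ (k' : Γ.K) (h : Γ.Hist), Γ.Reach (pomdpSigma' Γ pstar σ Kc n0) (s * n0) (k, []) (k', h) →
      h.length = s * n0 ∧
      (∃ h₁, 0 < Γ.histProb pstar σ h₁ ∧ blockRep Γ pstar σ Kc n0 s h =
        repHistOfVal Γ pstar σ Kc (Γ.superSuppH σ Kc h₁)) ∧
      k' ∈ Γ.superSuppH σ Kc (blockRep Γ pstar σ Kc n0 s h) i := by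
  induction s with
  | zero =>
    intro k' h hr
    rw [Nat.zero_mul] at hr
    simp only [POMDP.Reach, Prod.mk.injEq] at hr
    obtain ⟨rfl, rfl⟩ := hr
    have hpos : 0 < Γ.histProb pstar σ [] :=
      Γ.histProb_pos σ pstar hp [] k k ((hKc k).2 ⟨i, hk⟩) rfl
    refine ⟨by simp, ⟨[], hpos, rfl⟩, ?_⟩
    rw [blockRep, repHist_spec _ _ _ _ _ hpos, Γ.mem_superSupp]
    exact ⟨k, hk, rfl⟩
  | succ s ih =>
    intro k'' h'' hr
    rw [Nat.succ_mul, Γ.Reach_add] at hr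
    obtain ⟨⟨k', h⟩, hr1, hr2⟩ := hr
    obtain ⟨hl, -, hmem⟩ := ih k' h hr1
    obtain ⟨w, hw1, hw2, hw3⟩ := Γ.Reach_transport (pomdpSigma' Γ pstar σ Kc n0) σ h
      (blockRep Γ pstar σ Kc n0 s h) n0
      (fun v hv => sigma'_append Γ pstar σ Kc n0 s h v hl hv) n0 k' [] (k'', h'') (by simp)
      (by simpa using hr2)
    simp only [List.append_nil, List.length_nil, Nat.zero_add] at hw1 hw2 hw3
    subst hw1
    rw [Γ.mem_superSupp] at hmem
    obtain ⟨k0, hk0, hr0⟩ := hmem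
    have hreach : Γ.Reach σ (blockRep Γ pstar σ Kc n0 s h ++ w).length (k0, [])
        (k'', blockRep Γ pstar σ Kc n0 s h ++ w) := by
      rw [List.length_append, hw2, Γ.Reach_add]
      exact ⟨_, hr0, hw3⟩
    have hpos := Γ.histProb_pos σ pstar hp _ k0 k'' ((hKc k0).2 ⟨i, hk0⟩) hreach
    have hrep : blockRep Γ pstar σ Kc n0 (s + 1) (h ++ w) = repHistOfVal Γ pstar σ Kc
        (Γ.superSuppH σ Kc (blockRep Γ pstar σ Kc n0 s h ++ w)) := by
      rw [blockRep, blockRep_append _ _ _ _ _ _ _ _ hl.ge, ← hl, List.drop_left,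
        List.take_of_length_le hw2.le]
    refine ⟨by rw [List.length_append, hl, hw2, Nat.succ_mul], ⟨_, hpos, hrep⟩, ?_⟩
    rw [hrep, repHist_spec _ _ _ _ _ hpos, Γ.mem_superSupp]
    exact ⟨k0, hk0, hreach⟩

lemma sum_range_mul' (f : ℕ → ℝ) (n S : ℕ) : ∑ j ∈ Finset.range (S * n), f j =
    ∑ s ∈ Finset.range S, ∑ m ∈ Finset.range n, f (s * n + m) := by
  induction S with
  | zero => simp
  | succ S ih => rw [Nat.succ_mul, Finset.sum_range_add, ih, Finset.sum_range_succ]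

/-- **Lemma 8.** If `n0` is such that, for every representative history `h^j`, every `i`
and every `k ∈ B^i[h^j]`, the expected average reward over `n0` stages under `σ[h^j]`
starting from `k` is at least `γ^i_∞ - ε`, then for every `S ≥ 1` the expected average
reward of `σ'` over the first `S·n0` stages, starting from `p*`, is at least
`γ^{p*}_∞(σ) - ε`. -/
theorem pomdp_block_payoff (Γ : POMDP)
    (pstar : Γ.K → ℝ) (hps : IsBelief pstar) (σ : Γ.Strategy)
    (herg : ∀ k, 0 < pstar k →
      ∀ᵐ ω ∂(Γ.envMeasure (diracBelief k)),
        Tendsto (Γ.avg σ ω) atTop (nhds (Γ.payK k σ)))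
    (r : ℕ) (Kc : Fin r → Finset Γ.K) (γv : Fin r → ℝ)
    (hKc : ∀ k, 0 < pstar k ↔ ∃ i, k ∈ Kc i)
    (hcl : ∀ i, ∀ k ∈ Kc i, Γ.payK k σ = γv i)
    (hdist : ∀ i j, i ≠ j → γv i ≠ γv j)
    (hne : ∀ i, (Kc i).Nonempty)
    (ε : ℝ) (hε : 0 < ε) (n0 : ℕ) (hn0 : 1 ≤ n0)
    (hblock : ∀ h : Γ.Hist, 0 < Γ.histProb pstar σ h → ∀ i : Fin r,
      ∀ k' ∈ Γ.superSuppH σ Kc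
          (repHistOfVal Γ pstar σ Kc (Γ.superSuppH σ Kc h)) i,
        γv i - ε ≤
          ∫ ω, Γ.avg (Γ.shiftStrat σ
              (repHistOfVal Γ pstar σ Kc (Γ.superSuppH σ Kc h))) ω n0
            ∂(Γ.envMeasure (diracBelief k'))) :
    ∀ S : ℕ, 1 ≤ S →
      Γ.pay pstar σ - ε ≤
        ∫ ω, Γ.avg (pomdpSigma' Γ pstar σ Kc n0) ω (S * n0)
          ∂(Γ.envMeasure pstar) := by
  intro S hS
  set σ' := pomdpSigma' Γ pstar σ Kc n0 with hσ'
  have hp := hps.1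
  have hn0' : (0 : ℝ) < n0 := by exact_mod_cast hn0
  have hS' : (0 : ℝ) < S := by exact_mod_cast hS
  have hlim : ∀ k, 0 < pstar k → ∀ᵐ ω ∂(Γ.envMeasure (diracBelief k)),
      atTop.liminf (Γ.avg σ ω) = Γ.payK k σ := fun k hk => by
    filter_upwards [herg k hk] with ω hω using hω.liminf_eq
  have hpay : Γ.pay pstar σ = ∑ k, pstar k * Γ.payK k σ := by
    rw [POMDP.pay, Γ.integral_env pstar hp]
    · rfl
    · intro k hk
      exact (integrable_const (Γ.payK k σ)).congr ((hlim k hk).mono fun ω h => h.symm)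
  rw [Γ.integral_env pstar hp _ (fun k _ => Γ.integrable_avg σ' k _), hpay]
  have hε' : ε = ∑ k, pstar k * ε := by rw [← Finset.sum_mul, hps.2, one_mul]
  conv_lhs => rw [hε']
  rw [← Finset.sum_sub_distrib]
  refine Finset.sum_le_sum fun k _ => ?_
  rw [← mul_sub]
  rcases (hp k).eq_or_lt with h0 | h0
  · rw [← h0]; simp
  refine mul_le_mul_of_nonneg_left ?_ h0.le
  obtain ⟨i, hi⟩ := (hKc k).1 h0
  rw [hcl i k hi, Γ.integral_avg, sum_range_mul']
  have hb : ∀ s ∈ Finset.range S, n0 * (γv i - ε) ≤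
      ∑ m ∈ Finset.range n0, (Γ.T σ')^[s * n0 + m] (Γ.G σ') (k, []) := by
    intro s _
    simp only [Function.iterate_add_apply]
    rw [← Γ.T_sum σ' (s * n0) n0 (fun m => (Γ.T σ')^[m] (Γ.G σ'))]
    refine Γ.T_ge σ' _ _ _ _ ?_
    rintro ⟨k', h⟩ hr
    obtain ⟨hl, ⟨h₁, hh₁, hrep⟩, hmem⟩ := block_inv Γ pstar hp σ Kc hKc n0 i k hi s k' h hr
    rw [hrep] at hmem
    have hbl := hblock h₁ hh₁ i k' hmem
    rw [← hrep, Γ.integral_avg] at hbl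
    have hag : ∀ v : Γ.Hist, v.length < n0 → σ' (h ++ v) =
        Γ.shiftStrat σ (blockRep Γ pstar σ Kc n0 s h) ([] ++ v) := fun v hv =>
      sigma'_append Γ pstar σ Kc n0 s h v hl hv
    have e : ∑ m ∈ Finset.range n0, (Γ.T σ')^[m] (Γ.G σ') (k', h) =
        ∑ m ∈ Finset.range n0, (Γ.T (Γ.shiftStrat σ (blockRep Γ pstar σ Kc n0 s h)))^[m]
          (Γ.G (Γ.shiftStrat σ (blockRep Γ pstar σ Kc n0 s h))) (k', []) := by
      refine Finset.sum_congr rfl fun m hm => ?_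
      have := Γ.T_transport σ' _ h [] n0 hag (Γ.G σ')
        (Γ.G (Γ.shiftStrat σ (blockRep Γ pstar σ Kc n0 s h)))
        (fun k v hv => by simp only [POMDP.G]; rw [hag v hv]) m k' []
        (by simpa using hm)
      simpa using this
    rw [e]
    rw [one_div, ← div_eq_inv_mul, le_div_iff₀ hn0'] at hbl
    linarith
  have hsum := Finset.sum_le_sum hb
  rw [Finset.sum_const, Finset.card_range, nsmul_eq_mul] at hsum
  rw [one_div, ← div_eq_inv_mul, le_div_iff₀ (by push_cast; positivity)]
  push_cast
  linarith

end PomdpPaper
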